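/- For any positive integer n and any odd positive integer m, the number of conjugacy classes of the full orthogonal group O(2n+1) consisting of elements x with x^m = 1 equals C(n + ⌊m/2⌋, ⌊m/2⌋). -/

import Mathlib

open Matrix

/-- Two real square matrices are orthogonally similar if an orthogonal matrix conjugates one
to the other. -/
def OrthSim {ι κ : Type*} [Fintype ι] [DecidableEq ι] [Fintype κ] [DecidableEq κ]
    (A : Matrix ι ι ℝ) (B : Matrix κ κ ℝ) : Prop :=
  ∃ Q : Matrix ι κ ℝ, Qᵀ * Q = 1 ∧ Q * Qᵀ = 1 ∧ A = Q * B * Qᵀ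

namespace OrthSim

variable {ι κ τ : Type*} [Fintype ι] [DecidableEq ι] [Fintype κ] [DecidableEq κ]
  [Fintype τ] [DecidableEq τ]

theorem trans {A : Matrix ι ι ℝ} {B : Matrix κ κ ℝ} {C : Matrix τ τ ℝ}
    (h₁ : OrthSim A B) (h₂ : OrthSim B C) : OrthSim A C := by
  obtain ⟨P, hP, hP', rfl⟩ := h₁
  obtain ⟨Q, hQ, hQ', rfl⟩ := h₂
  refine ⟨P * Q, ?_, ?_, ?_⟩
  · rw [transpose_mul, Matrix.mul_assoc, ← Matrix.mul_assoc Pᵀ, hP, Matrix.one_mul, hQ]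
  · rw [transpose_mul, Matrix.mul_assoc, ← Matrix.mul_assoc Q, hQ', Matrix.one_mul, hP']
  · simp only [transpose_mul, Matrix.mul_assoc]

theorem symm {A : Matrix ι ι ℝ} {B : Matrix κ κ ℝ} (h : OrthSim A B) : OrthSim B A := by
  obtain ⟨P, hP, hP', rfl⟩ := h
  refine ⟨Pᵀ, by simpa using hP', by simpa using hP, ?_⟩
  rw [transpose_transpose, Matrix.mul_assoc, Matrix.mul_assoc, hP, Matrix.mul_one,
    ← Matrix.mul_assoc, hP, Matrix.one_mul]

theorem of_submatrix (A : Matrix ι ι ℝ) (e : κ ≃ ι) : OrthSim (A.submatrix e e) A := by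
  refine ⟨(1 : Matrix ι ι ℝ).submatrix e id, ?_, ?_, ?_⟩
  · rw [transpose_submatrix, submatrix_mul_equiv _ _ _ e, transpose_one, Matrix.one_mul,
      submatrix_id_id]
  · rw [transpose_submatrix, submatrix_mul _ _ _ id _ Function.bijective_id |>.symm]
    simp
  · ext i j
    simp [Matrix.mul_apply, Matrix.one_apply]

theorem fromBlocks (R : Matrix ι ι ℝ) {A : Matrix κ κ ℝ} {B : Matrix τ τ ℝ} (h : OrthSim A B) :
    OrthSim (Matrix.fromBlocks R 0 0 A) (Matrix.fromBlocks R 0 0 B) := by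
  obtain ⟨P, hP, hP', rfl⟩ := h
  refine ⟨Matrix.fromBlocks 1 0 0 P, ?_, ?_, ?_⟩ <;>
    simp [fromBlocks_transpose, fromBlocks_multiply, hP, hP']

theorem charpoly_eq {A B : Matrix ι ι ℝ} (h : OrthSim A B) : A.charpoly = B.charpoly := by
  obtain ⟨P, hP, hP', rfl⟩ := h
  rw [Matrix.charpoly_mul_comm, ← Matrix.mul_assoc, hP, Matrix.one_mul]

theorem pow_eq_one {A : Matrix ι ι ℝ} {B : Matrix κ κ ℝ} (h : OrthSim A B) {m : ℕ}
    (hA : A ^ m = 1) : B ^ m = 1 := by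
  obtain ⟨P, hP, hP', rfl⟩ := h.symm
  have key : ∀ k : ℕ, (P * A * Pᵀ) ^ k = P * A ^ k * Pᵀ := fun k => by
    induction k with
    | zero => simp [hP']
    | succ k ih =>
      rw [pow_succ, ih, pow_succ]
      simp only [Matrix.mul_assoc]
      rw [← Matrix.mul_assoc Pᵀ, hP, Matrix.one_mul]
  rw [key, hA, Matrix.mul_one, hP']

theorem transpose_mul_self {A : Matrix ι ι ℝ} {B : Matrix κ κ ℝ} (h : OrthSim A B)
    (hA : Aᵀ * A = 1) : Bᵀ * B = 1 := by
  obtain ⟨P, hP, hP', rfl⟩ := h.symm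
  simp only [transpose_mul, transpose_transpose, Matrix.mul_assoc]
  rw [← Matrix.mul_assoc Pᵀ, hP, Matrix.one_mul, ← Matrix.mul_assoc Aᵀ, hA, Matrix.one_mul, hP']

end OrthSim

/-- Matrix of the rotation of the plane by the angle `θ`. -/
noncomputable def planeRotation (θ : ℝ) : Matrix (Fin 2) (Fin 2) ℝ :=
  !![Real.cos θ, -Real.sin θ; Real.sin θ, Real.cos θ]

theorem planeRotation_add (θ φ : ℝ) :
    planeRotation (θ + φ) = planeRotation θ * planeRotation φ := by
  ext i j
  fin_cases i <;> fin_cases j <;>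
    simp [planeRotation, Matrix.mul_apply, Fin.sum_univ_two, Real.cos_add, Real.sin_add] <;> ring

theorem planeRotation_zero : planeRotation 0 = 1 := by
  simp [planeRotation, Matrix.one_fin_two]

theorem planeRotation_pow (θ : ℝ) (k : ℕ) : planeRotation θ ^ k = planeRotation (k * θ) := by
  induction k with
  | zero => simp [planeRotation_zero]
  | succ k ih => rw [pow_succ, ih, ← planeRotation_add]; push_cast; ring_nf

theorem transpose_planeRotation (θ : ℝ) : (planeRotation θ)ᵀ = planeRotation (-θ) := by
  ext i j
  fin_cases i <;> fin_cases j <;> simp [planeRotation]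

theorem transpose_planeRotation_mul_self (θ : ℝ) :
    (planeRotation θ)ᵀ * planeRotation θ = 1 := by
  rw [transpose_planeRotation, ← planeRotation_add, neg_add_cancel, planeRotation_zero]

open Polynomial in
theorem charpoly_planeRotation (θ : ℝ) :
    (planeRotation θ).charpoly = X ^ 2 - C (2 * Real.cos θ) * X + 1 := by
  have h : Real.cos θ * Real.cos θ + Real.sin θ * Real.sin θ = 1 := by
    nlinarith [Real.sin_sq_add_cos_sq θ]
  rw [charpoly_fin_two]
  simp [planeRotation, Matrix.trace, Matrix.det_fin_two, h, two_mul]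

/-- The block diagonal matrix with plane rotations by the angles `θ i` and a final block `1`. -/
noncomputable def rotationForm {τ : Type*} [DecidableEq τ] (θ : τ → ℝ) :
    Matrix ((Fin 2 × τ) ⊕ Unit) ((Fin 2 × τ) ⊕ Unit) ℝ :=
  Matrix.fromBlocks (blockDiagonal fun i => planeRotation (θ i)) 0 0 1

section rotationForm

variable {τ : Type*} [Fintype τ] [DecidableEq τ]

theorem transpose_rotationForm_mul_self (θ : τ → ℝ) :
    (rotationForm θ)ᵀ * rotationForm θ = 1 := by
  simp only [rotationForm, fromBlocks_transpose, fromBlocks_multiply, blockDiagonal_transpose,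
    ← blockDiagonal_mul, transpose_planeRotation_mul_self]
  have : (blockDiagonal fun _ : τ => (1 : Matrix (Fin 2) (Fin 2) ℝ)) = 1 := blockDiagonal_one
  simp [this]

theorem rotationForm_pow_eq_one {θ : τ → ℝ} {m : ℕ} (h : ∀ i, planeRotation (θ i) ^ m = 1) :
    rotationForm θ ^ m = 1 := by
  have : (fun i => planeRotation (θ i)) ^ m = 1 := funext h
  rw [rotationForm, fromBlocks_diagonal_pow, ← blockDiagonal_pow, this, blockDiagonal_one]
  simp

theorem charpoly_blockDiagonal {R ι : Type*} [CommRing R] [Fintype ι] [DecidableEq ι]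
    (M : τ → Matrix ι ι R) : (blockDiagonal M).charpoly = ∏ i, (M i).charpoly := by
  have : (blockDiagonal M).charmatrix = blockDiagonal fun i => (M i).charmatrix := by
    ext ⟨i, a⟩ ⟨j, b⟩
    by_cases hab : a = b <;> by_cases hij : i = j <;>
      simp [blockDiagonal_apply, hab, hij]
  simp only [charpoly, this, det_blockDiagonal]

open Polynomial in
theorem charpoly_rotationForm (θ : τ → ℝ) :
    (rotationForm θ).charpoly = (∏ i, (X ^ 2 - C (2 * Real.cos (θ i)) * X + 1)) * (X - 1) := by
  rw [rotationForm, charpoly_fromBlocks_zero₂₁, charpoly_blockDiagonal, charpoly_one]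
  simp [charpoly_planeRotation]

theorem orthSim_rotationForm_comp (θ : τ → ℝ) (σ : Equiv.Perm τ) :
    OrthSim (rotationForm (θ ∘ σ)) (rotationForm θ) := by
  have : rotationForm (θ ∘ σ) = (rotationForm θ).submatrix
      (Equiv.sumCongr (Equiv.prodCongr (Equiv.refl _) σ) (Equiv.refl _))
      (Equiv.sumCongr (Equiv.prodCongr (Equiv.refl _) σ) (Equiv.refl _)) := by
    ext (⟨i, a⟩ | i) (⟨j, b⟩ | j) <;> simp [rotationForm, blockDiagonal_apply]
  rw [this]
  exact .of_submatrix _ _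

theorem orthSim_rotationForm_cons {n : ℕ} (t : ℝ) (θ : Fin n → ℝ) :
    OrthSim (Matrix.fromBlocks (planeRotation t) 0 0 (rotationForm θ))
      (rotationForm (Fin.cons t θ : Fin (n + 1) → ℝ)) := by
  let f : Fin 2 ⊕ ((Fin 2 × Fin n) ⊕ Unit) → (Fin 2 × Fin (n + 1)) ⊕ Unit :=
    Sum.elim (fun i => .inl (i, 0)) (Sum.map (Prod.map id Fin.succ) id)
  have hf : Function.Bijective f := by
    constructor
    · rintro (i | ⟨i, a⟩ | i) (j | ⟨j, b⟩ | j) h <;> simp_all [f, Fin.ext_iff]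
    · rintro (⟨i, a⟩ | i)
      · cases a using Fin.cases with
        | zero => exact ⟨.inl i, rfl⟩
        | succ a => exact ⟨.inr (.inl (i, a)), rfl⟩
      · exact ⟨.inr (.inr i), rfl⟩
  have : Matrix.fromBlocks (planeRotation t) 0 0 (rotationForm θ) =
      (rotationForm (Fin.cons t θ : Fin (n + 1) → ℝ)).submatrix (Equiv.ofBijective f hf)
        (Equiv.ofBijective f hf) := by
    ext (i | ⟨i, a⟩ | i) (j | ⟨j, b⟩ | j) <;>
      simp [rotationForm, f, blockDiagonal_apply, (Fin.succ_ne_zero _).symm]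
  rw [this]
  exact .of_submatrix _ _

end rotationForm

open Polynomial in
theorem isCoprime_quadratic {a b : ℝ} (h : a ≠ b) :
    IsCoprime (X ^ 2 - C (2 * a) * X + 1 : ℝ[X]) (X ^ 2 - C (2 * b) * X + 1) := by
  have hab : C (2 * b - 2 * a) * C (2 * b - 2 * a)⁻¹ = (1 : ℝ[X]) := by
    rw [← C_mul, mul_inv_cancel₀ (by contrapose! h; linarith), C_1]
  refine ⟨1 - (X - C (2 * a)) * C (2 * b - 2 * a)⁻¹, (X - C (2 * a)) * C (2 * b - 2 * a)⁻¹, ?_⟩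
  rw [C_sub] at hab
  linear_combination (-X ^ 2 + C (2 * a) * X) * hab

open Polynomial in
theorem natDegree_quadratic (a : ℝ) : (X ^ 2 - C (2 * a) * X + 1 : ℝ[X]).natDegree = 2 := by
  compute_degree!

open Polynomial in
theorem multiset_eq_of_prod_quadratic_eq {α : Type*} {c : α → ℝ} (hc : c.Injective)
    (s t : Multiset α)
    (h : (s.map fun j => (X ^ 2 - C (2 * c j) * X + 1 : ℝ[X])).prod =
      (t.map fun j => (X ^ 2 - C (2 * c j) * X + 1 : ℝ[X])).prod) : s = t := by
  classical
  have hunit : ∀ a : ℝ, ¬ IsUnit (X ^ 2 - C (2 * a) * X + 1 : ℝ[X]) := fun a hu => by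
    have := natDegree_eq_zero_of_isUnit hu
    rw [natDegree_quadratic] at this
    omega
  induction s using Multiset.induction generalizing t with
  | empty =>
    rcases t.empty_or_exists_mem with rfl | ⟨b, hb⟩
    · rfl
    · have hdvd := Multiset.dvd_prod
        (Multiset.mem_map_of_mem (fun j => (X ^ 2 - C (2 * c j) * X + 1 : ℝ[X])) hb)
      rw [← h] at hdvd
      exact absurd (isUnit_of_dvd_one (by simpa using hdvd)) (hunit _)
  | cons a s ih =>
    have hat : a ∈ t := by
      by_contra hat
      have hcop : IsCoprime (X ^ 2 - C (2 * c a) * X + 1 : ℝ[X])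
          (t.map fun j => (X ^ 2 - C (2 * c j) * X + 1 : ℝ[X])).prod := by
        refine Multiset.prod_induction (fun p => IsCoprime _ p) _ (fun _ _ => IsCoprime.mul_right)
          isCoprime_one_right fun p hp => ?_
        obtain ⟨b, hb, rfl⟩ := Multiset.mem_map.1 hp
        exact isCoprime_quadratic fun hab => hat (hc hab ▸ hb)
      refine hunit _ (hcop.isUnit_of_dvd' dvd_rfl ?_)
      rw [← h, Multiset.map_cons, Multiset.prod_cons]
      exact dvd_mul_right _ _
    obtain ⟨u, rfl⟩ := Multiset.exists_cons_of_mem hat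
    simp only [Multiset.map_cons, Multiset.prod_cons] at h
    rw [ih u (mul_left_cancel₀ (fun h0 => ?_) h)]
    have := natDegree_quadratic (c a)
    rw [h0] at this
    simp at this

theorem exists_perm_of_map_univ_eq {τ α : Type*} [Fintype τ] {f g : τ → α}
    (h : Multiset.map f Finset.univ.val = Multiset.map g Finset.univ.val) :
    ∃ σ : Equiv.Perm τ, f = g ∘ σ := by
  classical
  have hcard : ∀ a, Nonempty ({i // f i = a} ≃ {i // g i = a}) := fun a => by
    rw [← Fintype.card_eq, Fintype.card_subtype, Fintype.card_subtype]
    have := congrArg (Multiset.count a) h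
    simpa [Multiset.count_map, Finset.card_def, Finset.filter_val, eq_comm] using this
  refine ⟨(Equiv.sigmaFiberEquiv f).symm.trans ((Equiv.sigmaCongrRight fun a =>
    (hcard a).some).trans (Equiv.sigmaFiberEquiv g)), funext fun i => ?_⟩
  exact ((hcard (f i)).some ⟨i, rfl⟩).2.symm

theorem exists_cos_sub_mul_self_eq_zero {m : ℕ} (hodd : Odd m) {μ : ℂ} (hμ : μ ^ m = 1)
    (hμ1 : μ ≠ 1) : ∃ j : ℕ, 0 < j ∧ j ≤ m / 2 ∧
      μ ^ 2 - 2 * (Real.cos (2 * Real.pi * j / m) : ℝ) * μ + 1 = 0 := by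
  have hm : m ≠ 0 := hodd.pos.ne'
  have : NeZero m := ⟨hm⟩
  obtain ⟨i, hi, rfl⟩ := (Complex.isPrimitiveRoot_exp m hm).eq_pow_of_pow_eq_one hμ
  have hi0 : i ≠ 0 := by rintro rfl; simp at hμ1
  have key : (Complex.exp (2 * Real.pi * Complex.I / m) ^ i) ^ 2 -
      2 * (Real.cos (2 * Real.pi * i / m) : ℝ) * Complex.exp (2 * Real.pi * Complex.I / m) ^ i
        + 1 = 0 := by
    have h1 : Complex.exp (2 * Real.pi * Complex.I / m) ^ i =
        Complex.exp ((2 * Real.pi * i / m : ℝ) * Complex.I) := by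
      rw [← Complex.exp_nat_mul]
      push_cast
      congr 1
      ring
    rw [h1, Complex.ofReal_cos, Complex.two_cos]
    have h2 : Complex.exp (-((2 * Real.pi * i / m : ℝ) : ℂ) * Complex.I) *
        Complex.exp ((2 * Real.pi * i / m : ℝ) * Complex.I) = 1 := by
      rw [← Complex.exp_add]; simp
    linear_combination -h2
  rcases Nat.lt_or_ge (m / 2) i with h | h
  · refine ⟨m - i, by omega, by omega, ?_⟩
    have : Real.cos (2 * Real.pi * (m - i : ℕ) / m) = Real.cos (2 * Real.pi * i / m) := by
      rw [← Real.cos_two_pi_sub (2 * Real.pi * i / m), Nat.cast_sub hi.le]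
      congr 1
      have : (m : ℝ) ≠ 0 := by exact_mod_cast hm
      field_simp
    rw [this]
    exact key
  · exact ⟨i, by omega, h, key⟩

open Polynomial in
theorem exists_mulVec_mulVec_eq {ι : Type*} [Fintype ι] [DecidableEq ι] {A : Matrix ι ι ℝ} {m : ℕ}
    (hodd : Odd m) (hA : A ^ m = 1) (hA1 : A ≠ 1) :
    ∃ j : ℕ, 0 < j ∧ j ≤ m / 2 ∧ ∃ v : ι → ℝ, v ≠ 0 ∧
      A *ᵥ (A *ᵥ v) = (2 * Real.cos (2 * Real.pi * j / m)) • (A *ᵥ v) - v := by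
  have : Nonempty ι := by
    by_contra h
    rw [not_nonempty_iff] at h
    exact hA1 (Subsingleton.elim _ _)
  let B : Matrix ι ι ℂ := A.map Complex.ofRealHom
  have hB : B ^ m = 1 := by rw [← Matrix.map_pow, hA]; simp
  have hB1 : B ≠ 1 := fun h => hA1 <|
    Matrix.map_injective Complex.ofRealHom.injective (by simpa [B] using h)
  let p : ℂ[X] := ∑ i ∈ Finset.range m, X ^ i
  have hp : aeval B p * (B - 1) = 0 := by
    have : aeval B p = ∑ i ∈ Finset.range m, B ^ i := by simp [p]
    rw [this, geom_sum_mul, hB, sub_self]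
  have h0 : (0 : ℂ) ∈ spectrum ℂ (aeval B p) := by
    rw [spectrum.zero_mem_iff]
    intro hu
    exact hB1 (sub_eq_zero.1 (hu.mul_right_eq_zero.1 hp))
  have hne : (spectrum ℂ B).Nonempty := spectrum.nonempty_of_isAlgClosed_of_finiteDimensional ℂ B
  rw [spectrum.map_polynomial_aeval_of_nonempty _ _ hne] at h0
  obtain ⟨μ, hμ, hμp⟩ := h0
  have hμp' : ∑ i ∈ Finset.range m, μ ^ i = 0 := by
    simpa [p, eval_finsetSum] using hμp
  have hμ1 : μ ≠ 1 := by
    rintro rfl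
    simp [hodd.pos.ne'] at hμp'
  have hμm : μ ^ m = 1 := by
    have := geom_sum_mul μ m
    rw [hμp', zero_mul] at this
    exact (sub_eq_zero.1 this.symm)
  obtain ⟨j, hj0, hj, hjμ⟩ := exists_cos_sub_mul_self_eq_zero hodd hμm hμ1
  refine ⟨j, hj0, hj, ?_⟩
  set c := Real.cos (2 * Real.pi * j / m)
  let q : ℝ[X] := X ^ 2 - C (2 * c) * X + 1
  have hq0 : (0 : ℂ) ∈ spectrum ℂ (aeval B (q.map Complex.ofRealHom)) := by
    rw [spectrum.map_polynomial_aeval_of_nonempty _ _ hne]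
    exact ⟨μ, hμ, by simpa [q] using hjμ⟩
  have hmap : aeval B (q.map Complex.ofRealHom) =
      (A * A - (2 * c) • A + 1).map Complex.ofRealHom := by
    simp only [q, Polynomial.map_add, Polynomial.map_sub, Polynomial.map_mul, Polynomial.map_pow,
      map_X, map_C, Polynomial.map_one, map_add, map_sub, map_mul, map_pow, aeval_X, aeval_C, map_one]
    ext a b
    have h1 : (1 : Matrix ι ι ℂ) a b = ((1 : Matrix ι ι ℝ) a b : ℂ) := by
      simp [Matrix.one_apply, apply_ite]
    simp [B, pow_two, Matrix.mul_apply, Algebra.algebraMap_eq_smul_one, h1, mul_assoc,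
      mul_left_comm (c : ℂ)]
  rw [spectrum.zero_mem_iff, hmap, Matrix.isUnit_iff_isUnit_det, isUnit_iff_ne_zero, not_not] at hq0
  have hdet : (A * A - (2 * c) • A + 1).det = 0 := by
    apply Complex.ofRealHom.injective
    rw [RingHom.map_det, map_zero]
    exact hq0
  obtain ⟨v, hv, h⟩ := Matrix.exists_mulVec_eq_zero_iff.2 hdet
  refine ⟨v, hv, ?_⟩
  rw [Matrix.add_mulVec, Matrix.sub_mulVec, Matrix.smul_mulVec, Matrix.one_mulVec,
    ← Matrix.mulVec_mulVec] at h
  rw [← sub_eq_zero, ← h]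
  abel

/-- An orthogonal matrix of odd order rotates some plane. -/
theorem exists_rotation_plane {ι : Type*} [Fintype ι] [DecidableEq ι] [Nontrivial ι]
    {A : Matrix ι ι ℝ} {m : ℕ} (hodd : Odd m) (hA : A ^ m = 1) (hAo : Aᵀ * A = 1) :
    ∃ j : ℕ, j ≤ m / 2 ∧ ∃ u w : ι → ℝ, u ⬝ᵥ u = 1 ∧ w ⬝ᵥ w = 1 ∧ u ⬝ᵥ w = 0 ∧
      A *ᵥ u = Real.cos (2 * Real.pi * j / m) • u + Real.sin (2 * Real.pi * j / m) • w ∧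
      A *ᵥ w = -Real.sin (2 * Real.pi * j / m) • u + Real.cos (2 * Real.pi * j / m) • w := by
  by_cases hA1 : A = 1
  · obtain ⟨a, b, hab⟩ := exists_pair_ne ι
    exact ⟨0, Nat.zero_le _, Pi.single a 1, Pi.single b 1, by simp, by simp, by simp [hab],
      by rw [hA1, one_mulVec]; simp, by rw [hA1, one_mulVec]; simp⟩
  obtain ⟨j, hj0, hj, v, hv, hAv⟩ := exists_mulVec_mulVec_eq hodd hA hA1
  refine ⟨j, hj, ?_⟩
  have hm : (0 : ℝ) < m := by exact_mod_cast hodd.pos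
  have hs : 0 < Real.sin (2 * Real.pi * j / m) := by
    have hj2 : (2 * j : ℝ) < m := by
      have : 2 * j < m := by obtain ⟨k, rfl⟩ := hodd; omega
      exact_mod_cast this
    have hj0' : (0 : ℝ) < j := by exact_mod_cast hj0
    apply Real.sin_pos_of_pos_of_lt_pi
    · positivity
    · rw [div_lt_iff₀ hm]
      nlinarith [Real.pi_pos]
  have hsc := Real.sin_sq_add_cos_sq (2 * Real.pi * j / m)
  set c := Real.cos (2 * Real.pi * j / m)
  set s := Real.sin (2 * Real.pi * j / m)
  have hiso : ∀ x y : ι → ℝ, (A *ᵥ x) ⬝ᵥ (A *ᵥ y) = x ⬝ᵥ y := fun x y => by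
    rw [Matrix.dotProduct_mulVec, Matrix.vecMul_mulVec, hAo, Matrix.vecMul_one]
  have hvv : 0 < v ⬝ᵥ v := by
    have := Matrix.dotProduct_star_self_pos_iff.2 hv
    simpa using this
  obtain ⟨u, hu, hAu⟩ : ∃ u : ι → ℝ, u ⬝ᵥ u = 1 ∧
      A *ᵥ (A *ᵥ u) = (2 * c) • (A *ᵥ u) - u := by
    refine ⟨(Real.sqrt (v ⬝ᵥ v))⁻¹ • v, ?_, ?_⟩
    · simp only [smul_dotProduct, dotProduct_smul, smul_eq_mul]
      rw [← mul_assoc, ← mul_inv, Real.mul_self_sqrt hvv.le, inv_mul_cancel₀ hvv.ne']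
    · simp only [Matrix.mulVec_smul, hAv, smul_sub, smul_comm (Real.sqrt (v ⬝ᵥ v))⁻¹]
  have huA : u ⬝ᵥ A *ᵥ u = c := by
    have h1 := hiso u (A *ᵥ u)
    have h2 := hiso u u
    rw [hAu, dotProduct_sub, dotProduct_smul, h2, hu, dotProduct_comm (A *ᵥ u) u, smul_eq_mul] at h1
    linarith
  have hAA : A *ᵥ u ⬝ᵥ A *ᵥ u = 1 := by rw [hiso, hu]
  refine ⟨u, s⁻¹ • (A *ᵥ u - c • u), hu, ?_, ?_, ?_, ?_⟩
  · simp only [smul_dotProduct, dotProduct_smul, sub_dotProduct, dotProduct_sub, smul_eq_mul, hu, huA,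
      dotProduct_comm (A *ᵥ u) u, hAA]
    field_simp
    linear_combination -hsc
  · simp [dotProduct_smul, dotProduct_sub, hu, huA]
  · rw [smul_smul, mul_inv_cancel₀ hs.ne', one_smul]
    abel
  · rw [Matrix.mulVec_smul, Matrix.mulVec_sub, hAu, Matrix.mulVec_smul]
    ext i
    simp only [Pi.smul_apply, Pi.sub_apply, Pi.add_apply, smul_eq_mul]
    field_simp
    linear_combination u i * hsc

theorem exists_orthSim_fromBlocks {ι κ : Type*} [Fintype ι] [DecidableEq ι] [Fintype κ]
    [DecidableEq κ] (hcard : Fintype.card ι = Fintype.card κ + 2) {A : Matrix ι ι ℝ}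
    (hA : Aᵀ * A = 1) {t : ℝ} {u w : ι → ℝ} (huu : u ⬝ᵥ u = 1) (hww : w ⬝ᵥ w = 1)
    (huw : u ⬝ᵥ w = 0) (hAu : A *ᵥ u = Real.cos t • u + Real.sin t • w)
    (hAw : A *ᵥ w = -Real.sin t • u + Real.cos t • w) :
    ∃ D : Matrix κ κ ℝ, OrthSim A (Matrix.fromBlocks (planeRotation t) 0 0 D) := by
  have hwu : w ⬝ᵥ u = 0 := by rw [dotProduct_comm, huw]
  let v : Fin 2 ⊕ κ → EuclideanSpace ℝ ι := Sum.elim ![WithLp.toLp 2 u, WithLp.toLp 2 w] 0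
  have hv : Orthonormal ℝ ((Set.range Sum.inl).domRestrict v) := by
    rw [orthonormal_iff_ite]
    rintro ⟨_, i, rfl⟩ ⟨_, j, rfl⟩
    rw [EuclideanSpace.inner_eq_star_dotProduct]
    fin_cases i <;> fin_cases j <;> simp [v, huu, hww, huw, hwu]
  obtain ⟨b, hb⟩ := hv.exists_orthonormalBasis_extension_of_card_eq
    (by simp [hcard, add_comm] : Module.finrank ℝ (EuclideanSpace ℝ ι) = Fintype.card (Fin 2 ⊕ κ))
  let Q : Matrix ι (Fin 2 ⊕ κ) ℝ := Matrix.of fun i x => b x i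
  have hQ : Qᵀ * Q = 1 := by
    ext x y
    have := orthonormal_iff_ite.1 b.orthonormal y x
    rw [EuclideanSpace.inner_eq_star_dotProduct] at this
    simpa [Q, Matrix.mul_apply, dotProduct, Matrix.one_apply, eq_comm] using this
  have hQ' : Q * Qᵀ = 1 := (mul_eq_one_comm_of_card_eq _ _ _ (by
    rw [Fintype.card_sum, Fintype.card_fin, hcard, add_comm])).1 hQ
  have hsim : OrthSim A (Qᵀ * A * Q) := by
    refine ⟨Q, hQ, hQ', ?_⟩
    rw [Matrix.mul_assoc, Matrix.mul_assoc, hQ', Matrix.mul_one, ← Matrix.mul_assoc, hQ',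
      Matrix.one_mul]
  have hu : Q *ᵥ Pi.single (.inl 0) 1 = u := by
    ext i
    simp [Q, hb (.inl 0) ⟨0, rfl⟩, v]
  have hw : Q *ᵥ Pi.single (.inl 1) 1 = w := by
    ext i
    simp [Q, hb (.inl 1) ⟨1, rfl⟩, v]
  have hBu : (Qᵀ * A * Q) *ᵥ Pi.single (.inl 0) 1 =
      Real.cos t • Pi.single (.inl 0) 1 + Real.sin t • Pi.single (.inl 1) 1 := by
    rw [← Matrix.mulVec_mulVec, ← Matrix.mulVec_mulVec, hu, hAu, ← hu, ← hw]
    simp only [Matrix.mulVec_add, Matrix.mulVec_smul]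
    simp only [Matrix.mulVec_mulVec, hQ, Matrix.one_mulVec]
  have hBw : (Qᵀ * A * Q) *ᵥ Pi.single (.inl 1) 1 =
      -Real.sin t • Pi.single (.inl 0) 1 + Real.cos t • Pi.single (.inl 1) 1 := by
    rw [← Matrix.mulVec_mulVec, ← Matrix.mulVec_mulVec, hw, hAw, ← hu, ← hw]
    simp only [Matrix.mulVec_add, Matrix.mulVec_smul]
    simp only [Matrix.mulVec_mulVec, hQ, Matrix.one_mulVec]
  have hBo := hsim.transpose_mul_self hA
  generalize Qᵀ * A * Q = B at hsim hBu hBw hBo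
  have h₁₁ : B.toBlocks₁₁ = planeRotation t := by
    ext i j
    have h0 := congrFun hBu
    have h1 := congrFun hBw
    simp only [mulVec_single_one, col_apply, Pi.add_apply, Pi.smul_apply] at h0 h1
    fin_cases i <;> fin_cases j <;> simp [planeRotation, toBlocks₁₁, h0, h1]
  have h₂₁ : B.toBlocks₂₁ = 0 := by
    ext i j
    have h0 := congrFun hBu
    have h1 := congrFun hBw
    simp only [mulVec_single_one, col_apply, Pi.add_apply, Pi.smul_apply] at h0 h1
    fin_cases j <;> simp [toBlocks₂₁, h0, h1]
  have hB := B.fromBlocks_toBlocks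
  rw [h₁₁, h₂₁] at hB
  have h₁₂ : B.toBlocks₁₂ = 0 := by
    rw [← hB, fromBlocks_transpose, fromBlocks_multiply, ← fromBlocks_one] at hBo
    have h := (fromBlocks_inj.1 hBo).2.1
    rw [Matrix.transpose_zero, Matrix.zero_mul, add_zero] at h
    have := congrArg (planeRotation t * ·) h
    simpa [← Matrix.mul_assoc, mul_eq_one_comm.1 (transpose_planeRotation_mul_self t)] using this
  rw [h₁₂] at hB
  exact ⟨B.toBlocks₂₂, hB ▸ hsim⟩

/-- An orthogonal matrix of odd size and odd order `m` is orthogonally similar to a direct sum of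
rotations by multiples of `2π/m` and a trivial block. -/
theorem exists_orthSim_rotationForm {m : ℕ} (hodd : Odd m) (n : ℕ)
    (A : Matrix (Fin (2 * n + 1)) (Fin (2 * n + 1)) ℝ) (hA : A ^ m = 1) (hAo : Aᵀ * A = 1) :
    ∃ g : Fin n → Fin (m / 2 + 1),
      OrthSim A (rotationForm fun i => 2 * Real.pi * (g i : ℕ) / m) := by
  induction n with
  | zero =>
    have : Subsingleton (Fin (2 * 0 + 1)) := inferInstanceAs (Subsingleton (Fin 1))
    refine ⟨Fin.elim0, ?_⟩
    have hA1 : A = 1 := by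
      have hdiag : A = Matrix.diagonal fun _ => A 0 0 := by
        ext i j
        rw [Subsingleton.elim i 0, Subsingleton.elim j 0]
        rfl
      rw [hdiag, Matrix.diagonal_pow, ← Matrix.diagonal_one] at hA
      have h : A 0 0 ^ m = 1 ^ m := by
        rw [one_pow]
        exact congrFun (Matrix.diagonal_injective hA) 0
      rw [hdiag, hodd.strictMono_pow.injective h, Matrix.diagonal_one]
    let e : Fin (2 * 0 + 1) ≃ (Fin 2 × Fin 0) ⊕ Unit := Fintype.equivOfCardEq (by simp)
    convert OrthSim.of_submatrix (rotationForm _) e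
    ext i j
    rw [Subsingleton.elim i 0, Subsingleton.elim j 0, hA1, submatrix_apply]
    rcases e 0 with ⟨_, x⟩ | x
    · exact x.elim0
    · simp [rotationForm]
  | succ n ih =>
    have : Nontrivial (Fin (2 * (n + 1) + 1)) := Fin.nontrivial_iff_two_le.2 (by omega)
    obtain ⟨j, hj, u, w, huu, hww, huw, hAu, hAw⟩ := exists_rotation_plane hodd hA hAo
    obtain ⟨D, hD⟩ := exists_orthSim_fromBlocks (κ := Fin (2 * n + 1)) (by simp; omega) hAo huu hww
      huw hAu hAw
    have hDo := hD.transpose_mul_self hAo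
    have hDm := hD.pow_eq_one hA
    rw [fromBlocks_diagonal_pow, ← fromBlocks_one] at hDm
    rw [fromBlocks_transpose, fromBlocks_multiply, ← fromBlocks_one] at hDo
    obtain ⟨g, hg⟩ := ih D (fromBlocks_inj.1 hDm).2.2.2
      (by simpa using (fromBlocks_inj.1 hDo).2.2.2)
    refine ⟨Fin.cons ⟨j, by omega⟩ g, ?_⟩
    convert (hD.trans (hg.fromBlocks _)).trans (orthSim_rotationForm_cons _ _) using 2
    ext i
    cases i using Fin.cases <;> simp

theorem cos_two_pi_mul_div_injective {m : ℕ} (hm : 0 < m) :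
    Function.Injective fun j : Fin (m / 2 + 1) => Real.cos (2 * Real.pi * (j : ℕ) / m) := by
  have hm' : (0 : ℝ) < m := by exact_mod_cast hm
  have hmem : ∀ j : Fin (m / 2 + 1), 2 * Real.pi * (j : ℕ) / m ∈ Set.Icc 0 Real.pi := fun j => by
    have hj : (2 * (j : ℕ) : ℝ) ≤ m := by
      have : 2 * (j : ℕ) ≤ m := by omega
      exact_mod_cast this
    refine ⟨by positivity, ?_⟩
    rw [div_le_iff₀ hm']
    nlinarith [Real.pi_pos]
  intro i j h
  have := Real.injOn_cos (hmem i) (hmem j) h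
  have hpi := Real.pi_ne_zero
  field_simp at this
  exact Fin.ext (by exact_mod_cast this)

theorem orthSim_rotationForm_iff {τ : Type*} [Fintype τ] [DecidableEq τ] {m : ℕ} (hm : 0 < m)
    (f g : τ → Fin (m / 2 + 1)) :
    OrthSim (rotationForm fun i => 2 * Real.pi * (f i : ℕ) / m)
      (rotationForm fun i => 2 * Real.pi * (g i : ℕ) / m) ↔
    Multiset.map f Finset.univ.val = Multiset.map g Finset.univ.val := by
  constructor
  · intro h
    have h := h.charpoly_eq
    rw [charpoly_rotationForm, charpoly_rotationForm] at h
    refine multiset_eq_of_prod_quadratic_eq (cos_two_pi_mul_div_injective hm) _ _ ?_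
    simp only [Multiset.map_map]
    exact mul_right_cancel₀ (Polynomial.X_sub_C_ne_zero 1) h
  · intro h
    obtain ⟨σ, rfl⟩ := exists_perm_of_map_univ_eq h
    exact orthSim_rotationForm_comp (fun i => 2 * Real.pi * (g i : ℕ) / m) σ

theorem isConj_iff_orthSim {ι : Type*} [Fintype ι] [DecidableEq ι]
    (A B : Matrix.orthogonalGroup ι ℝ) :
    IsConj A B ↔ OrthSim (A : Matrix ι ι ℝ) (B : Matrix ι ι ℝ) := by
  rw [isConj_comm, isConj_iff]
  constructor
  · rintro ⟨c, rfl⟩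
    exact ⟨c, (mem_orthogonalGroup_iff' _ _).1 c.2, (mem_orthogonalGroup_iff _ _).1 c.2, rfl⟩
  · rintro ⟨Q, hQ, hQ', h⟩
    exact ⟨⟨Q, (mem_orthogonalGroup_iff _ _).2 hQ'⟩, Subtype.ext h.symm⟩

theorem exists_orthogonalGroup_orthSim_rotationForm {m : ℕ} (hm : 0 < m) {n : ℕ}
    (g : Fin n → Fin (m / 2 + 1)) :
    ∃ A : Matrix.orthogonalGroup (Fin (2 * n + 1)) ℝ, A ^ m = 1 ∧
      OrthSim A.1 (rotationForm fun i => 2 * Real.pi * (g i : ℕ) / m) := by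
  let e : Fin (2 * n + 1) ≃ (Fin 2 × Fin n) ⊕ Unit := Fintype.equivOfCardEq (by simp)
  have h := OrthSim.of_submatrix (rotationForm fun i => 2 * Real.pi * (g i : ℕ) / m) e
  refine ⟨⟨_, (mem_orthogonalGroup_iff' _ _).2
    (h.symm.transpose_mul_self (transpose_rotationForm_mul_self _))⟩, Subtype.ext ?_, h⟩
  refine h.symm.pow_eq_one (rotationForm_pow_eq_one fun i => ?_)
  have hm' : (m : ℝ) ≠ 0 := by exact_mod_cast hm.ne'
  rw [planeRotation_pow, mul_div_cancel₀ _ hm', mul_comm, planeRotation, Real.cos_nat_mul_two_pi,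
    Real.sin_periodic.nat_mul_eq, Real.sin_zero, neg_zero, one_fin_two]

theorem exists_map_univ_eq {α : Type*} {n : ℕ} (s : Sym α n) :
    ∃ g : Fin n → α, Multiset.map g Finset.univ.val = s := by
  obtain ⟨s, rfl⟩ := s
  induction s using Quotient.inductionOn with
  | h l => exact ⟨l.get, (Fin.univ_val_map l.get).trans (congrArg _ (List.ofFn_get l))⟩

/-- For any positive integer `n` and odd positive integer `m`, the number of conjugacy
classes of the full orthogonal group `O(2n+1)` consisting of elements `x` with `x ^ m = 1`
equals `C(n + ⌊m/2⌋, ⌊m/2⌋)`. -/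
theorem stmt_11 (n m : ℕ) (hn : 0 < n) (hm : 0 < m) (hodd : Odd m) :
    {c : ConjClasses (Matrix.orthogonalGroup (Fin (2 * n + 1)) ℝ) |
        ∀ x ∈ c.carrier, x ^ m = 1}.ncard
      = Nat.choose (n + m / 2) (m / 2) := by
  choose g hg using fun s : Sym (Fin (m / 2 + 1)) n => exists_map_univ_eq s
  choose A hA hsim using
    fun s => exists_orthogonalGroup_orthSim_rotationForm hm (g s)
  have hconj (s t) : ConjClasses.mk (A s) = ConjClasses.mk (A t) → s = t := fun h => by
    rw [ConjClasses.mk_eq_mk_iff_isConj, isConj_iff_orthSim] at h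
    have := (orthSim_rotationForm_iff hm _ _).1 (((hsim s).symm.trans h).trans (hsim t))
    rw [hg, hg] at this
    exact Subtype.ext this
  have hset : {c : ConjClasses (Matrix.orthogonalGroup (Fin (2 * n + 1)) ℝ) |
      ∀ x ∈ c.carrier, x ^ m = 1} = Set.range fun s => ConjClasses.mk (A s) := by
    ext c
    constructor
    · intro hc
      obtain ⟨B, rfl⟩ := ConjClasses.exists_rep c
      obtain ⟨f, hf⟩ := exists_orthSim_rotationForm hodd n B.1
        (congrArg Subtype.val (hc B ConjClasses.mem_carrier_mk)) ((mem_orthogonalGroup_iff' _ _).1 B.2)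
      let s : Sym (Fin (m / 2 + 1)) n := ⟨Multiset.map f Finset.univ.val, by simp⟩
      refine ⟨s, ?_⟩
      rw [ConjClasses.mk_eq_mk_iff_isConj, isConj_iff_orthSim]
      exact ((hsim s).trans ((orthSim_rotationForm_iff hm _ _).2 (hg s))).trans hf.symm
    · rintro ⟨s, rfl⟩ x hx
      rw [ConjClasses.mem_carrier_iff_mk_eq, ConjClasses.mk_eq_mk_iff_isConj,
        isConj_iff_orthSim] at hx
      exact Subtype.ext (hx.symm.pow_eq_one (congrArg Subtype.val (hA s)))
  rw [hset, ← Set.image_univ, Set.ncard_image_of_injective _ fun s t => hconj s t, Set.ncard_univ,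
    Nat.card_eq_fintype_card, Sym.card_sym_eq_choose, Fintype.card_fin]
  rw [show m / 2 + 1 + n - 1 = n + m / 2 by omega, Nat.choose_symm_add]
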